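/- (Rate of convergence / approximation-uncertainty bound.) Assume b_j − ε_j ≤ (A η)_j ≤ b_j + ε_j for every j, let g^{bf} ∈ Δ_k^n attain sup_{g ∈ Δ_k^n} inf_{z ∈ P(b,ε)} z·log g, and suppose θ* ∈ ℝ^m satisfies A g^{(θ*)} = A η. Then d(g^{(θ*)}, g^{bf}) ≤ 2 Σ_{j=1}^m ε_j·|θ*_j| ≤ 2·(max_j ε_j)·(Σ_j |θ*_j|). -/

import Mathlib

open Finset

attribute [local instance] Classical.propDecidable

noncomputable section

/-- The simplex `Δ_k^n`: rows are probability distributions over `Fin k`. -/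
def Simplex (n k : ℕ) : Set (Fin n → Fin k → ℝ) :=
  {z | (∀ i ℓ, 0 ≤ z i ℓ) ∧ ∀ i, ∑ ℓ, z i ℓ = 1}

/-- Number of points where rule `j` does not abstain. -/
def nRule {n k p : ℕ} (h : Fin p → Fin n → Option (Fin k)) (j : Fin p) : ℕ :=
  (Finset.univ.filter (fun i => h j i ≠ none)).card

/-- The constraint matrix `A`, with `m = p + k` rows indexed by `Fin p ⊕ Fin k`. -/
def Amat {n k p : ℕ} (h : Fin p → Fin n → Option (Fin k)) :
    Fin p ⊕ Fin k → Fin n → Fin k → ℝ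
  | Sum.inl j => fun i ℓ => if h j i = some ℓ then 1 / (nRule h j : ℝ) else 0
  | Sum.inr ℓ' => fun i ℓ => if ℓ = ℓ' then 1 / (n : ℝ) else 0

/-- `(A z)_j`. -/
def applyA {n k p : ℕ} (h : Fin p → Fin n → Option (Fin k))
    (z : Fin n → Fin k → ℝ) (j : Fin p ⊕ Fin k) : ℝ :=
  ∑ i, ∑ ℓ, Amat h j i ℓ * z i ℓ

/-- The polytope `P(b, ε)`. -/
def Polytope {n k p : ℕ} (h : Fin p → Fin n → Option (Fin k))
    (b ε : Fin p ⊕ Fin k → ℝ) : Set (Fin n → Fin k → ℝ) :=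
  {z | z ∈ Simplex n k ∧ ∀ j, b j - ε j ≤ applyA h z j ∧ applyA h z j ≤ b j + ε j}

/-- Extended-real logarithm, with `elog 0 = ⊥ = -∞`. -/
def elog (x : ℝ) : EReal := if x = 0 then ⊥ else ((Real.log x : ℝ) : EReal)

/-- `z · log g`, valued in `[-∞, 0]` with the convention `0 · log 0 = 0`. -/
def dotlog {n k : ℕ} (z g : Fin n → Fin k → ℝ) : EReal :=
  ∑ i, ∑ ℓ, (z i ℓ : EReal) * elog (g i ℓ)

/-- `a^{(θ)}_{iℓ} = Σ_j θ_j · A j i ℓ`. -/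
def avec {n k p : ℕ} (h : Fin p → Fin n → Option (Fin k))
    (θ : Fin p ⊕ Fin k → ℝ) (i : Fin n) (ℓ : Fin k) : ℝ :=
  ∑ j, θ j * Amat h j i ℓ

/-- The exponential-family (softmax) prediction `g^{(θ)}`. -/
def gexp {n k p : ℕ} (h : Fin p → Fin n → Option (Fin k))
    (θ : Fin p ⊕ Fin k → ℝ) (i : Fin n) (ℓ : Fin k) : ℝ :=
  Real.exp (avec h θ i ℓ) / ∑ ℓ', Real.exp (avec h θ i ℓ')

/-- The BF dual objective `(σ'−σ)·b − (σ'+σ)·ε − Σ_i log(Σ_ℓ exp(a^{(σ'−σ)}_{iℓ}))`. -/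
def dualObj {n k p : ℕ} (h : Fin p → Fin n → Option (Fin k))
    (b ε σ σ' : Fin p ⊕ Fin k → ℝ) : ℝ :=
  (∑ j, (σ' j - σ j) * b j) - (∑ j, (σ' j + σ j) * ε j)
    - ∑ i, Real.log (∑ ℓ, Real.exp (avec h (fun j => σ' j - σ j) i ℓ))

/-- KL summand `a·log(a/c)`, with `0·log(0/c) = 0` and `a·log(a/0) = ⊤` for `a ≠ 0`. -/
def klTerm (a c : ℝ) : EReal :=
  if a = 0 then 0 else if c = 0 then ⊤ else ((a * Real.log (a / c) : ℝ) : EReal)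

/-- `d(μ, ν)`, the summed KL divergences, valued in `[0, +∞]`. -/
def dKL {n k : ℕ} (μ ν : Fin n → Fin k → ℝ) : EReal :=
  ∑ i, ∑ ℓ, klTerm (μ i ℓ) (ν i ℓ)

/-- Unnormalized one-coin Dawid–Skene score `N_{iℓ}`. -/
def Nds {n k p : ℕ} (h : Fin p → Fin n → Option (Fin k))
    (w : Fin k → ℝ) (β : Fin p → ℝ) (i : Fin n) (ℓ : Fin k) : ℝ :=
  w ℓ * (∏ j ∈ Finset.univ.filter (fun j => h j i = some ℓ), β j)
    * ∏ j ∈ Finset.univ.filter (fun j => ∃ ℓ' ≠ ℓ, h j i = some ℓ'),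
        (1 - β j) / ((k : ℝ) - 1)

/-- The one-coin Dawid–Skene prediction `g^{ds}(w, β)`. -/
def gds {n k p : ℕ} (h : Fin p → Fin n → Option (Fin k))
    (w : Fin k → ℝ) (β : Fin p → ℝ) (i : Fin n) (ℓ : Fin k) : ℝ :=
  Nds h w β i ℓ / ∑ ℓ', Nds h w β i ℓ'

lemma ereal_coe_sum {ι : Type*} (s : Finset ι) (f : ι → ℝ) :
    ((∑ i ∈ s, f i : ℝ) : EReal) = ∑ i ∈ s, (f i : EReal) := by
  induction s using Finset.induction_on with
  | empty => simp
  | insert a s ha ih => rw [Finset.sum_insert ha, Finset.sum_insert ha, EReal.coe_add, ih]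

lemma ereal_sum_eq_bot {ι : Type*} [Fintype ι] (f : ι → EReal) (i : ι) (hi : f i = ⊥) :
    ∑ i, f i = ⊥ := by
  classical
  rw [← Finset.add_sum_erase _ _ (Finset.mem_univ i), hi, EReal.bot_add]

lemma dotlog_eq_coe {n k : ℕ} (z g : Fin n → Fin k → ℝ) (hg : ∀ i ℓ, g i ℓ ≠ 0) :
    dotlog z g = ((∑ i, ∑ ℓ, z i ℓ * Real.log (g i ℓ) : ℝ) : EReal) := by
  simp [dotlog, elog, hg, ereal_coe_sum]

lemma dotlog_eq_bot {n k : ℕ} (z g : Fin n → Fin k → ℝ) (i : Fin n) (ℓ : Fin k)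
    (hz : 0 < z i ℓ) (hg : g i ℓ = 0) : dotlog z g = ⊥ := by
  refine ereal_sum_eq_bot _ i (ereal_sum_eq_bot _ ℓ ?_)
  rw [elog, if_pos hg, EReal.coe_mul_bot_of_pos hz]

lemma dKL_eq_coe {n k : ℕ} (μ ν : Fin n → Fin k → ℝ) (hμ : ∀ i ℓ, μ i ℓ ≠ 0)
    (hν : ∀ i ℓ, ν i ℓ ≠ 0) :
    dKL μ ν = ((∑ i, ∑ ℓ, μ i ℓ * Real.log (μ i ℓ) - ∑ i, ∑ ℓ, μ i ℓ * Real.log (ν i ℓ) : ℝ)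
      : EReal) := by
  simp only [dKL, klTerm, hμ, hν, if_false, ← ereal_coe_sum, ← Finset.sum_sub_distrib, ← mul_sub,
    Real.log_div (hμ _ _) (hν _ _)]

section Softmax

variable {n k p : ℕ} (h : Fin p → Fin n → Option (Fin k)) (θ : Fin p ⊕ Fin k → ℝ)

lemma sum_exp_avec_pos (hk : 0 < k) (i : Fin n) : 0 < ∑ ℓ, Real.exp (avec h θ i ℓ) :=
  Finset.sum_pos (fun _ _ => Real.exp_pos _) ⟨⟨0, hk⟩, Finset.mem_univ _⟩

lemma gexp_pos (hk : 0 < k) (i : Fin n) (ℓ : Fin k) : 0 < gexp h θ i ℓ :=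
  div_pos (Real.exp_pos _) (sum_exp_avec_pos h θ hk i)

lemma gexp_mem_simplex (hk : 0 < k) : gexp h θ ∈ Simplex n k := by
  refine ⟨fun i ℓ => (gexp_pos h θ hk i ℓ).le, fun i => ?_⟩
  simp only [gexp]
  rw [← Finset.sum_div, div_self (sum_exp_avec_pos h θ hk i).ne']

lemma sum_mul_avec (z : Fin n → Fin k → ℝ) :
    ∑ i, ∑ ℓ, z i ℓ * avec h θ i ℓ = ∑ j, θ j * applyA h z j := by
  simp only [avec, applyA, Finset.mul_sum]
  conv_rhs => rw [Finset.sum_comm]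
  refine Finset.sum_congr rfl fun i _ => ?_
  conv_rhs => rw [Finset.sum_comm]
  exact Finset.sum_congr rfl fun ℓ _ => Finset.sum_congr rfl fun j _ => by ring

lemma sum_mul_log_gexp (hk : 0 < k) {z : Fin n → Fin k → ℝ} (hz : z ∈ Simplex n k) :
    ∑ i, ∑ ℓ, z i ℓ * Real.log (gexp h θ i ℓ)
      = ∑ j, θ j * applyA h z j - ∑ i, Real.log (∑ ℓ, Real.exp (avec h θ i ℓ)) := by
  rw [← sum_mul_avec, ← Finset.sum_sub_distrib]
  refine Finset.sum_congr rfl fun i _ => ?_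
  simp only [gexp, Real.log_div (Real.exp_pos _).ne' (sum_exp_avec_pos h θ hk i).ne',
    Real.log_exp, mul_sub, Finset.sum_sub_distrib, ← Finset.sum_mul, hz.2 i, one_mul]

end Softmax

/-- rate of convergence / approximation-uncertainty bound. -/
theorem stmt8 {n k p : ℕ} (hn : 0 < n) (hk : 2 ≤ k) (hp : 0 < p)
    (h : Fin p → Fin n → Option (Fin k)) (hnj : ∀ j, 0 < nRule h j)
    (η : Fin n → Fin k → ℝ) (hη : η ∈ Simplex n k)
    (b ε : Fin p ⊕ Fin k → ℝ)
    (hmem : ∀ j, b j - ε j ≤ applyA h η j ∧ applyA h η j ≤ b j + ε j)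
    (gbf : Fin n → Fin k → ℝ) (hgbf : gbf ∈ Simplex n k)
    (hopt : (⨅ z ∈ Polytope h b ε, dotlog z gbf)
        = ⨆ g ∈ Simplex n k, ⨅ z ∈ Polytope h b ε, dotlog z g)
    (θstar : Fin p ⊕ Fin k → ℝ)
    (hmatch : ∀ j, applyA h (gexp h θstar) j = applyA h η j) :
    dKL (gexp h θstar) gbf ≤ ((2 * ∑ j, ε j * |θstar j| : ℝ) : EReal)
    ∧ ((2 * ∑ j, ε j * |θstar j| : ℝ) : EReal)
        ≤ ((2 * (⨆ j, ε j) * ∑ j, |θstar j| : ℝ) : EReal) := by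
  have hk0 : 0 < k := by omega
  have hgP : gexp h θstar ∈ Polytope h b ε :=
    ⟨gexp_mem_simplex h θstar hk0, fun j => by rw [hmatch]; exact hmem j⟩
  have hpos := gexp_pos h θstar hk0
  have hlower : ((∑ i, ∑ ℓ, gexp h θstar i ℓ * Real.log (gexp h θstar i ℓ)
      - 2 * ∑ j, ε j * |θstar j| : ℝ) : EReal) ≤ dotlog (gexp h θstar) gbf := by
    refine le_trans ?_ (iInf₂_le (f := fun z _ => dotlog z gbf) _ hgP)
    rw [hopt]
    refine le_trans (le_iInf₂ fun z hz => ?_)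
      (le_iSup₂ (f := fun g _ => ⨅ z ∈ Polytope h b ε, dotlog z g) _ hgP.1)
    rw [dotlog_eq_coe _ _ fun i ℓ => (hpos i ℓ).ne', EReal.coe_le_coe_iff,
      sum_mul_log_gexp h θstar hk0 hgP.1, sum_mul_log_gexp h θstar hk0 hz.1]
    have key : ∑ j, θstar j * applyA h (gexp h θstar) j - ∑ j, θstar j * applyA h z j
        ≤ 2 * ∑ j, ε j * |θstar j| := by
      rw [← Finset.sum_sub_distrib, Finset.mul_sum]
      refine Finset.sum_le_sum fun j _ => ?_
      have hdiff : |applyA h (gexp h θstar) j - applyA h z j| ≤ 2 * ε j := by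
        rw [abs_le]
        constructor <;> linarith [(hgP.2 j).1, (hgP.2 j).2, (hz.2 j).1, (hz.2 j).2]
      calc _ = θstar j * (applyA h (gexp h θstar) j - applyA h z j) := by ring
        _ ≤ |θstar j| * |applyA h (gexp h θstar) j - applyA h z j| :=
          (le_abs_self _).trans_eq (abs_mul _ _)
        _ ≤ |θstar j| * (2 * ε j) := mul_le_mul_of_nonneg_left hdiff (abs_nonneg _)
        _ = _ := by ring
    linarith
  constructor
  · have hne : ∀ i ℓ, gbf i ℓ ≠ 0 := fun i ℓ h0 => by
      rw [dotlog_eq_bot _ _ i ℓ (hpos i ℓ) h0] at hlower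
      exact EReal.coe_ne_bot _ (le_bot_iff.mp hlower)
    rw [dotlog_eq_coe _ _ hne, EReal.coe_le_coe_iff] at hlower
    rw [dKL_eq_coe _ _ (fun i ℓ => (hpos i ℓ).ne') hne, EReal.coe_le_coe_iff]
    linarith
  · rw [EReal.coe_le_coe_iff, mul_assoc, Finset.mul_sum univ _ (⨆ j, ε j)]
    gcongr with j
    exact le_ciSup (Set.finite_range ε).bddAbove j
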